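/- For every integer n ≥ 8 and every real number t ≥ 3/2, Ω(Z_n; t − 1/2) > (E_n / n!) · t^n. In particular, for every integer n ≥ 8 and every integer p ≥ 3, Ω(Z_n; p/2 − 1/2) > (E_n / n!) · (p/2)^n. -/

import Mathlib

/-- Order-preserving condition for maps from the zigzag poset `Z_n`
(order generated by `z_{2i} < z_{2i-1}` and `z_{2i} < z_{2i+1}`) to `{1, …, t}`. -/
def ZigzagMono (n t : ℕ) (f : Fin n → Fin t) : Prop :=
  ∀ j : ℕ, (h : j + 1 < n) →
    if Odd j then f ⟨j, Nat.lt_of_succ_lt h⟩ ≤ f ⟨j + 1, h⟩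
    else f ⟨j + 1, h⟩ ≤ f ⟨j, Nat.lt_of_succ_lt h⟩

/-- The Euler number `E_k`: the number of alternating permutations `σ` of `{1,…,k}`
with `σ(1) > σ(2) < σ(3) > ⋯`; equivalently the number of linear extensions of `Z_k`. -/
noncomputable def EulerNumber (k : ℕ) : ℕ :=
  Nat.card {σ : Equiv.Perm (Fin k) // ∀ i : ℕ, (h : i + 1 < k) →
    if Even i then σ ⟨i + 1, h⟩ < σ ⟨i, Nat.lt_of_succ_lt h⟩
    else σ ⟨i, Nat.lt_of_succ_lt h⟩ < σ ⟨i + 1, h⟩}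


namespace ZZ
open PowerSeries

noncomputable section

abbrev PS := PowerSeries ℚ

def sn : PS := PowerSeries.sin ℚ
def cs : PS := PowerSeries.cos ℚ

lemma cs0 : constantCoeff cs = 1 := by
  rw [← coeff_zero_eq_constantCoeff_apply]
  simp [cs, PowerSeries.cos]
lemma sn0 : constantCoeff sn = 0 := by
  rw [← coeff_zero_eq_constantCoeff_apply]
  simp [sn, PowerSeries.sin]

lemma dsn : d⁄dX ℚ sn = cs := by
  ext n
  rw [coeff_derivative]
  simp only [sn, cs, PowerSeries.sin, PowerSeries.cos, coeff_mk, Nat.even_add_one]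
  have h : ((n : ℚ) + 1) ≠ 0 := by positivity
  by_cases hn : Even n
  · obtain ⟨m, rfl⟩ := hn
    have h1 : (m + m + 1) / 2 = m := by omega
    have h2 : (m + m) / 2 = m := by omega
    simp [h1, h2, Nat.factorial_succ]
    field_simp
  · simp [hn]

lemma dcs : d⁄dX ℚ cs = -sn := by
  ext n
  rw [coeff_derivative]
  simp only [sn, cs, PowerSeries.sin, PowerSeries.cos, coeff_mk, Nat.even_add_one, map_neg]
  have h : ((n : ℚ) + 1) ≠ 0 := by positivity
  by_cases hn : Even n
  · simp [hn]
  · obtain ⟨m, rfl⟩ := Nat.not_even_iff_odd.1 hn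
    have h1 : (2 * m + 1 + 1) / 2 = m + 1 := by omega
    have h2 : (2 * m + 1) / 2 = m := by omega
    simp [h1, h2, Nat.factorial_succ, pow_succ]
    field_simp

lemma csq : cs * cs + sn * sn = 1 := by
  apply derivative.ext
  · simp only [map_add, Derivation.leibniz, dsn, dcs, smul_eq_mul, Derivation.map_one_eq_zero]
    ring
  · simp [cs0, sn0]

/-- shift -/
def sh : PS →ₗ[ℚ] PS where
  toFun g := mk fun n => coeff (n + 1) g
  map_add' a b := by ext; simp
  map_smul' a b := by ext; simp

lemma sh_eq (g : PS) : g = X * sh g + C (constantCoeff g) := eq_X_mul_shift_add_const g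
lemma sh_X (g : PS) : sh (X * g) = g := by ext n; simp [sh, coeff_succ_X_mul]

def sg : PS := sh sn
lemma sn_eq : sn = X * sg := by simpa [sn0, sg] using sh_eq sn
lemma sg0 : constantCoeff sg = 1 := by
  rw [← coeff_zero_eq_constantCoeff_apply]
  simp [sg, sh, sn, PowerSeries.sin]
lemma sg_inv : sg * sg⁻¹ = 1 := PowerSeries.mul_inv_cancel _ (by simp [sg0])

/-- The variable `x = 2 sin θ`. -/
def xx : PS := 2 * sn

def qq : PS →ₗ[ℚ] PS := (1 / 2 : ℚ) • ((LinearMap.mulLeft ℚ (sg⁻¹)).comp sh)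

lemma qq_X (g : PS) : qq (X * g) = (1 / 2 : ℚ) • (sg⁻¹ * g) := by
  simp [qq, sh_X]
lemma qq_C (r : ℚ) : qq (C r) = 0 := by
  have : sh (C r) = 0 := by ext n; simp [sh]
  simp [qq, this]
lemma two_smul_half (g : PS) : (2 : PS) * ((1 / 2 : ℚ) • g) = g := by
  rw [mul_smul_comm, two_mul, ← two_nsmul, ← Nat.cast_smul_eq_nsmul ℚ, smul_smul]; norm_num
lemma qq_xx (g : PS) : qq (xx * g) = g := by
  have : xx * g = X * (2 * (sg * g)) := by rw [xx, sn_eq]; ring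
  rw [this, qq_X]
  have : sg⁻¹ * (2 * (sg * g)) = 2 * g := by linear_combination (2 * g) * sg_inv
  rw [this, ← mul_smul_comm, two_smul_half]
lemma qq_eq (g : PS) : g = C (constantCoeff g) + xx * qq g := by
  have h := sh_eq g
  have : xx * qq g = X * sh g := by
    conv_lhs => rw [h]
    rw [map_add, qq_C, add_zero, qq_X, xx, sn_eq]
    have := two_smul_half (sg⁻¹ * sh g)
    linear_combination X * sg * this + X * sh g * sg_inv
  rw [this, add_comm]; exact h

/-- coefficient of `x^n` in a series in θ. -/
def cc : ℕ → (PS →ₗ[ℚ] ℚ)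
  | 0 => coeff 0
  | n + 1 => (cc n).comp qq

lemma cc_zero (g : PS) : cc 0 g = constantCoeff g := by simp [cc]
lemma cc_succ_xx (n : ℕ) (g : PS) : cc (n + 1) (xx * g) = cc n g := by simp [cc, qq_xx]
lemma cc_zero_xx (g : PS) : cc 0 (xx * g) = 0 := by simp [cc_zero, xx, sn0]
lemma cc_succ_C (n : ℕ) (r : ℚ) : cc (n + 1) (C r) = 0 := by simp [cc, qq_C]
lemma cc_succ (n : ℕ) (g : PS) : cc (n + 1) g = cc n (qq g) := by simp [cc]

lemma cc_X_pow (n : ℕ) : ∀ g : PS, cc n (X ^ n * g) = constantCoeff g / 2 ^ n := by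
  induction n with
  | zero => intro g; simp [cc_zero]
  | succ n ih =>
    intro g
    have : (X : PS) ^ (n + 1) * g = X * (X ^ n * g) := by ring
    rw [cc_succ, this, qq_X, map_smul]
    have : sg⁻¹ * (X ^ n * g) = X ^ n * (sg⁻¹ * g) := by ring
    rw [this, ih]
    simp [sg0]; ring

lemma cs_inv : cs * cs⁻¹ = 1 := PowerSeries.mul_inv_cancel _ (by simp [cs0])

/-- existence of `dg/dx`. -/
lemma exD (g : PS) : ∃ h, d⁄dX ℚ g = 2 * cs * h := by
  refine ⟨(1 / 2 : ℚ) • (cs⁻¹ * d⁄dX ℚ g), ?_⟩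
  have := two_smul_half (cs⁻¹ * d⁄dX ℚ g)
  linear_combination -cs * this - d⁄dX ℚ g * cs_inv

lemma two_cs_ne : (2 * cs : PS) ≠ 0 := by
  intro h
  have := congrArg (constantCoeff (R := ℚ)) h
  rw [two_mul, map_add, cs0, map_zero] at this
  norm_num at this

lemma dxx : d⁄dX ℚ xx = 2 * cs := by
  have : xx = sn + sn := by rw [xx]; ring
  rw [this, map_add, dsn]; ring

lemma cc_deriv (n : ℕ) : ∀ g h : PS, d⁄dX ℚ g = 2 * cs * h →
    (n + 1 : ℚ) * cc (n + 1) g = cc n h := by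
  induction n with
  | zero =>
    intro g h H
    obtain ⟨r, hr⟩ := exD (qq g)
    have e : d⁄dX ℚ g = 2 * cs * (qq g + xx * r) := by
      conv_lhs => rw [qq_eq g]
      rw [map_add, derivative_C, Derivation.leibniz, dxx, hr]
      simp only [smul_eq_mul]; ring
    have : h = qq g + xx * r := mul_left_cancel₀ two_cs_ne (H.symm.trans e)
    rw [this, map_add, cc_zero_xx, cc_succ]; simp
  | succ n ih =>
    intro g h H
    obtain ⟨r, hr⟩ := exD (qq g)
    have e : d⁄dX ℚ g = 2 * cs * (qq g + xx * r) := by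
      conv_lhs => rw [qq_eq g]
      rw [map_add, derivative_C, Derivation.leibniz, dxx, hr]
      simp only [smul_eq_mul]; ring
    have : h = qq g + xx * r := mul_left_cancel₀ two_cs_ne (H.symm.trans e)
    rw [this, map_add, cc_succ_xx, cc_succ, ← ih _ _ hr]; push_cast; ring

lemma cc_xD (n : ℕ) (g h : PS) (H : d⁄dX ℚ g = 2 * cs * h) :
    cc n (xx * h) = n * cc n g := by
  cases n with
  | zero => simp [cc_zero_xx]
  | succ n => rw [cc_succ_xx, ← cc_deriv n g h H]; push_cast; ring

lemma cc_xxDD (n : ℕ) (g h r : PS) (H : d⁄dX ℚ g = 2 * cs * h) (H' : d⁄dX ℚ h = 2 * cs * r) :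
    cc n (xx * (xx * r)) = n * (n - 1) * cc n g := by
  cases n with
  | zero => simp [cc_zero_xx]
  | succ n => rw [cc_succ_xx, cc_xD n h r H', ← cc_deriv n g h H]; push_cast; ring

lemma cc_second (n : ℕ) (g : PS) :
    4 * (n + 2) * (n + 1) * cc (n + 2) g = n ^ 2 * cc n g + cc n (d⁄dX ℚ (d⁄dX ℚ g)) := by
  obtain ⟨h, H⟩ := exD g
  obtain ⟨r, H'⟩ := exD h
  have e : d⁄dX ℚ (d⁄dX ℚ g) = (4 : ℚ) • r - xx * h - xx * (xx * r) := by
    have : 2 * cs * h = cs * h + cs * h := by ring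
    have h4 : (4 : ℚ) • r = 4 * r := by
      rw [show (4 : ℚ) = ((4 : ℕ) : ℚ) by norm_num, Nat.cast_smul_eq_nsmul]; simp
    rw [H, this, map_add, Derivation.leibniz, dcs, H', h4, xx]
    simp only [smul_eq_mul]
    linear_combination 4 * r * csq
  rw [e, map_sub, map_sub, map_smul, cc_xD n g h H, cc_xxDD n g h r H H', ← cc_deriv n h r H']
  have := cc_deriv (n + 1) g h H
  push_cast at this
  simp only [smul_eq_mul]
  linear_combination (4 * (n + 1) : ℚ) * this

lemma cc_cos (m : ℕ) (g : PS) :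
    2 * (m + 1) * cc (m + 1) (cs * d⁄dX ℚ g) = cc m (d⁄dX ℚ (d⁄dX ℚ g)) - m * cc m g := by
  obtain ⟨h, H⟩ := exD g
  have e : cs * d⁄dX ℚ g = (2 : ℚ) • h - (1 / 2 : ℚ) • (xx * (xx * h)) := by
    have h2 : (2 : ℚ) • h = 2 * h := by
      rw [show (2 : ℚ) = ((2 : ℕ) : ℚ) by norm_num, Nat.cast_smul_eq_nsmul]; simp
    have : xx * (xx * h) = 2 * (2 * sn * sn * h) := by rw [xx]; ring
    rw [this, ← mul_smul_comm, two_smul_half, H, h2]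
    linear_combination 2 * h * csq
  rw [e, map_sub, map_smul, map_smul, cc_succ_xx, cc_xD m g h H]
  have h1 := cc_second m g
  have h2 := cc_deriv (m + 1) g h H
  push_cast at h2
  simp only [smul_eq_mul]
  rw [← h2]
  linear_combination h1

/-- `θ^k/k!` -/
def ee (k : ℕ) : PS := C (1 / (k.factorial : ℚ)) * X ^ k

lemma ee_eq_smul (k : ℕ) : ee k = (1 / (k.factorial : ℚ)) • (X : PS) ^ k := by
  rw [ee, smul_eq_C_mul]
lemma dee (k : ℕ) : d⁄dX ℚ (ee (k + 1)) = ee k := by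
  ext n
  rw [coeff_derivative]
  simp only [ee, coeff_C_mul, coeff_X_pow]
  by_cases h : n = k
  · subst h
    simp [Nat.factorial_succ]; field_simp
  · simp [h]
lemma dee0 : d⁄dX ℚ (ee 0) = 0 := by simp [ee]

def dd (m k : ℕ) : ℚ := cc m (ee k)

lemma dd_rec (m k : ℕ) : 4 * (m + 2) * (m + 1) * dd (m + 2) (k + 2) = m ^ 2 * dd m (k + 2) + dd m k := by
  have := cc_second m (ee (k + 2)); rwa [dee, dee] at this
lemma dd_rec0 (m : ℕ) : 4 * (m + 2) * (m + 1) * dd (m + 2) 0 = m ^ 2 * dd m 0 := by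
  have := cc_second m (ee 0); rwa [dee0, map_zero, map_zero, add_zero] at this
lemma dd_rec1 (m : ℕ) : 4 * (m + 2) * (m + 1) * dd (m + 2) 1 = m ^ 2 * dd m 1 := by
  have := cc_second m (ee 1); rwa [dee, dee0, map_zero, add_zero] at this

lemma dd_zero (k : ℕ) : dd 0 k = if k = 0 then 1 else 0 := by
  cases k <;> simp [dd, cc_zero, ee]
lemma dd_one (k : ℕ) : dd 1 k = if k = 1 then 1 / 2 else 0 := by
  match k with
  | 0 =>
    have : ee 0 = C 1 := by simp [ee]
    rw [dd, this, cc_succ_C]; simp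
  | 1 =>
    have : ee 1 = X ^ 1 * 1 := by simp [ee]
    rw [dd, this, cc_X_pow]; simp
  | k + 2 =>
    have : ee (k + 2) = X ^ 1 * (C (1 / ((k + 2).factorial : ℚ)) * X ^ (k + 1)) := by
      simp only [ee]; ring
    rw [dd, this, cc_X_pow]; simp

lemma dd_parity (m : ℕ) : ∀ k, Odd (m + k) → dd m k = 0 := by
  induction m using Nat.twoStepInduction with
  | zero => intro k hk; rw [dd_zero, if_neg]; rintro rfl; simp at hk
  | one => intro k hk; rw [dd_one, if_neg]; rintro rfl; revert hk; decide
  | more m ih _ =>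
    intro k hk
    have hpos : (4 * (m + 2) * (m + 1) : ℚ) ≠ 0 := by positivity
    apply mul_left_cancel₀ hpos
    match k with
    | 0 => rw [dd_rec0, ih 0 (by grind)]; simp
    | 1 => rw [dd_rec1, ih 1 (by grind)]; simp
    | k + 2 => rw [dd_rec, ih _ (by grind), ih _ (by grind)]; simp

lemma dd_nonneg (m : ℕ) : ∀ k, 0 ≤ dd m k := by
  induction m using Nat.twoStepInduction with
  | zero => intro k; rw [dd_zero]; split_ifs <;> norm_num
  | one => intro k; rw [dd_one]; split_ifs <;> norm_num
  | more m ih _ =>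
    intro k
    have hpos : (0 : ℚ) < 4 * (m + 2) * (m + 1) := by positivity
    apply nonneg_of_mul_nonneg_right _ hpos
    match k with
    | 0 => rw [dd_rec0]; have := ih 0; positivity
    | 1 => rw [dd_rec1]; have := ih 1; positivity
    | k + 2 => rw [dd_rec]; have := ih k; have := ih (k+2); positivity

/-- sign sequence -/
def bb (μ : ℚ) (m : ℕ) : ℕ → ℚ
  | 0 => - μ * dd m 1
  | k + 1 => dd m k - μ * dd m (k + 2)

lemma bb_parity (μ : ℚ) (m k : ℕ) (h : Even (m + k)) : bb μ m k = 0 := by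
  cases k with
  | zero => rw [bb, dd_parity _ _ (by grind)]; simp
  | succ k => rw [bb, dd_parity _ _ (by grind), dd_parity _ _ (by grind)]; simp

lemma bb_rec (μ : ℚ) (m k : ℕ) : 4 * (m + 2) * (m + 1) * bb μ (m + 2) (k + 2) =
    m ^ 2 * bb μ m (k + 2) + bb μ m k := by
  cases k with
  | zero => simp only [bb]; linear_combination dd_rec1 m - μ * dd_rec m 1
  | succ k => simp only [bb]; linear_combination dd_rec m k - μ * dd_rec m (k+2)
lemma bb_rec0 (μ : ℚ) (m : ℕ) : 4 * (m + 2) * (m + 1) * bb μ (m + 2) 0 = m ^ 2 * bb μ m 0 := by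
  simp only [bb]; linear_combination - μ * dd_rec1 m
lemma bb_rec1 (μ : ℚ) (m : ℕ) : 4 * (m + 2) * (m + 1) * bb μ (m + 2) 1 =
    m ^ 2 * bb μ m 1 - μ * dd m 0 := by
  simp only [bb]; linear_combination dd_rec0 m - μ * dd_rec m 0

lemma bb_sign (μ : ℚ) (hμ : 0 ≤ μ) (m : ℕ) : ∃ K, ∀ k, (k < K → bb μ m k ≤ 0) ∧
    (K ≤ k → 0 ≤ bb μ m k) := by
  induction m using Nat.twoStepInduction with
  | zero =>
    refine ⟨0, fun k => ⟨by omega, fun _ => ?_⟩⟩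
    match k with
    | 0 => simp [bb, dd_zero]
    | k + 1 => simp only [bb, dd_zero]; split_ifs <;> simp_all
  | one =>
    refine ⟨1, fun k => ⟨fun h => ?_, fun h => ?_⟩⟩
    · obtain rfl : k = 0 := by omega
      simp [bb, dd_one]; positivity
    · match k with
      | k + 1 => simp only [bb, dd_one]; split_ifs <;> simp_all
  | more m ih _ =>
    obtain ⟨K, hK⟩ := ih
    have hpos : (0 : ℚ) < 4 * (m + 2) * (m + 1) := by positivity
    have hm : (0 : ℚ) ≤ (m : ℚ) ^ 2 := by positivity
    have neg : ∀ k, k < K → bb μ (m + 2) k ≤ 0 := by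
      intro k hk
      apply nonpos_of_mul_nonpos_right _ hpos
      have h1 := mul_nonneg hm (neg_nonneg.2 ((hK k).1 hk))
      match k with
      | 0 => rw [bb_rec0]; linarith
      | 1 => rw [bb_rec1]; have := mul_nonneg hμ (dd_nonneg m 0); linarith
      | k + 2 => rw [bb_rec]; have := (hK k).1 (by omega); linarith
    have pos : ∀ k, K + 2 ≤ k → 0 ≤ bb μ (m + 2) k := by
      intro k hk
      apply nonneg_of_mul_nonneg_right _ hpos
      match k with
      | k + 2 =>
        rw [bb_rec]
        have := (hK k).2 (by omega)
        have h1 := mul_nonneg hm ((hK (k+2)).2 (by omega))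
        linarith
    -- the index in {K, K+1} with the right parity
    by_cases hpar : Even (m + 2 + K)
    · have z := bb_parity μ (m + 2) K hpar
      by_cases hs : 0 ≤ bb μ (m + 2) (K + 1)
      · refine ⟨K, fun k => ⟨neg k, fun h => ?_⟩⟩
        rcases (by omega : k = K ∨ k = K + 1 ∨ K + 2 ≤ k) with rfl | rfl | h
        · rw [z]
        · exact hs
        · exact pos k h
      · refine ⟨K + 2, fun k => ⟨fun h => ?_, pos k⟩⟩
        rcases (by omega : k = K ∨ k = K + 1 ∨ k < K) with rfl | rfl | h
        · rw [z]
        · linarith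
        · exact neg k h
    · have z := bb_parity μ (m + 2) (K + 1) (by grind)
      by_cases hs : 0 ≤ bb μ (m + 2) K
      · refine ⟨K, fun k => ⟨neg k, fun h => ?_⟩⟩
        rcases (by omega : k = K ∨ k = K + 1 ∨ K + 2 ≤ k) with rfl | rfl | h
        · exact hs
        · rw [z]
        · exact pos k h
      · refine ⟨K + 2, fun k => ⟨fun h => ?_, pos k⟩⟩
        rcases (by omega : k = K ∨ k = K + 1 ∨ k < K) with rfl | rfl | h
        · linarith
        · rw [z]
        · exact neg k h

lemma cc_cos_ee (m k : ℕ) : 2 * (m + 1) * cc (m + 1) (cs * ee k) = bb m m k := by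
  have := cc_cos m (ee (k + 1))
  cases k with
  | zero => rw [dee, dee0, map_zero] at this; rw [this]; simp [bb, dd]
  | succ k => rw [dee, dee] at this; rw [this]; simp [bb, dd]

lemma cos_sign (m : ℕ) : ∃ K, ∀ k, (k < K → cc (m + 1) (cs * X ^ k) ≤ 0) ∧
    (K ≤ k → 0 ≤ cc (m + 1) (cs * X ^ k)) := by
  obtain ⟨K, hK⟩ := bb_sign m (by positivity) m
  have key : ∀ k, cc (m + 1) (cs * X ^ k) = k.factorial / (2 * (m + 1)) * bb m m k := by
    intro k
    rw [← cc_cos_ee, ee_eq_smul, mul_smul_comm, map_smul, smul_eq_mul]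
    have : (k.factorial : ℚ) ≠ 0 := by positivity
    field_simp
  refine ⟨K, fun k => ⟨fun h => ?_, fun h => ?_⟩⟩
  · rw [key]; exact mul_nonpos_of_nonneg_of_nonpos (by positivity) ((hK k).1 h)
  · rw [key]; exact mul_nonneg (by positivity) ((hK k).2 h)

lemma cc_cos_top (n : ℕ) : cc n (cs * X ^ n) = 1 / 2 ^ n := by
  rw [mul_comm, cc_X_pow, cs0]

/-- truncation -/
lemma cc_expand (n : ℕ) (T : PS) : cc n (cs * T) =
    ∑ k ∈ Finset.range (n + 1), coeff k T * cc n (cs * X ^ k) := by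
  have h : (X : PS) ^ (n + 1) ∣ T - ∑ k ∈ Finset.range (n + 1), coeff k T • (X : PS) ^ k := by
    rw [X_pow_dvd_iff]
    intro m hm
    simp [coeff_X_pow, hm]
  obtain ⟨r, hr⟩ := h
  have e : cs * T = (∑ k ∈ Finset.range (n + 1), coeff k T • (cs * (X : PS) ^ k)) +
      X ^ n * (X * (cs * r)) := by
    have : (∑ k ∈ Finset.range (n + 1), coeff k T • (cs * (X : PS) ^ k)) =
        cs * ∑ k ∈ Finset.range (n + 1), coeff k T • (X : PS) ^ k := by
      rw [Finset.mul_sum]; exact Finset.sum_congr rfl fun k _ => (mul_smul_comm _ _ _).symm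
    rw [this]
    linear_combination cs * hr
  rw [e, map_add, map_sum, cc_X_pow]
  simp

/-! multiple angles -/
def CS : ℕ → PS × PS
  | 0 => (1, 0)
  | k + 1 => ((CS k).1 * cs - (CS k).2 * sn, (CS k).2 * cs + (CS k).1 * sn)

def cK (k : ℕ) : PS := (CS k).1
def sK (k : ℕ) : PS := (CS k).2
lemma cK0 : cK 0 = 1 := rfl
lemma sK0 : sK 0 = 0 := rfl
lemma cKs (k : ℕ) : cK (k + 1) = cK k * cs - sK k * sn := rfl
lemma sKs (k : ℕ) : sK (k + 1) = sK k * cs + cK k * sn := rfl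
lemma cK1 : cK 1 = cs := by simp [cKs, cK0, sK0]
lemma sK1 : sK 1 = sn := by simp [sKs, cK0, sK0]

lemma K_add (a b : ℕ) : cK (a + b) = cK a * cK b - sK a * sK b ∧
    sK (a + b) = sK a * cK b + cK a * sK b := by
  induction b with
  | zero => simp [cK0, sK0]
  | succ b ih =>
    rw [← add_assoc, cKs (a + b), sKs (a + b), cKs b, sKs b]
    constructor
    · rw [ih.1, ih.2]; ring
    · rw [ih.1, ih.2]; ring

lemma K_sq (a : ℕ) : cK a * cK a + sK a * sK a = 1 := by
  induction a with
  | zero => simp [cK0, sK0]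
  | succ b ih =>
    rw [cKs, sKs]
    linear_combination ih + (cK b * cK b + sK b * sK b) * csq

lemma K_const (a : ℕ) : constantCoeff (cK a) = 1 ∧ constantCoeff (sK a) = 0 := by
  induction a with
  | zero => simp [cK0, sK0]
  | succ b ih => simp [cKs, sKs, ih, cs0, sn0]

lemma K_der (a : ℕ) : d⁄dX ℚ (cK a) = - (a * sK a) ∧ d⁄dX ℚ (sK a) = a * cK a := by
  induction a with
  | zero => simp [cK0, sK0]
  | succ b ih =>
    rw [cKs, sKs, map_sub, map_add]
    simp only [Derivation.leibniz, ih.1, ih.2, dsn, dcs, smul_eq_mul]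
    push_cast
    constructor <;> ring

/-- `sec + tan` of `aθ`. -/
def TT (a : ℕ) : PS := (1 + sK a) * (cK a)⁻¹

lemma TT_mul (a : ℕ) : cK a * TT a = 1 + sK a := by
  have : cK a * (cK a)⁻¹ = 1 := PowerSeries.mul_inv_cancel _ (by simp [(K_const a).1])
  rw [TT]; linear_combination (1 + sK a) * this

lemma cK_ne (a : ℕ) : cK a ≠ 0 := by
  intro h
  have := congrArg (constantCoeff (R := ℚ)) h
  rw [(K_const a).1, map_zero] at this
  norm_num at this

lemma TT_mul' (a : ℕ) : sK a * TT a + cK a = TT a := by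
  apply mul_left_cancel₀ (cK_ne a)
  linear_combination (sK a - 1) * TT_mul a + K_sq a

lemma TT_der (a : ℕ) : 2 * d⁄dX ℚ (TT a) = a * (1 + TT a * TT a) := by
  have h := congrArg (d⁄dX ℚ) (TT_mul a)
  rw [Derivation.leibniz, map_add, (K_der a).1, (K_der a).2, derivative_one] at h
  simp only [smul_eq_mul] at h
  have h2 : cK a * d⁄dX ℚ (TT a) = a * TT a := by
    linear_combination h + a * TT_mul' a
  apply mul_left_cancel₀ (cK_ne a)
  apply mul_left_cancel₀ (cK_ne a)
  linear_combination 2 * cK a * h2 + a * (2 - (cK a * TT a + 1 + sK a)) * TT_mul a - a * K_sq a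

lemma TT_const (a : ℕ) : constantCoeff (TT a) = 1 := by
  have := congrArg (constantCoeff (R := ℚ)) (TT_mul a)
  simpa [(K_const a).1, (K_const a).2] using this

def tau (k : ℕ) : ℚ := coeff k (TT 1)

lemma TT_rec (a n : ℕ) : 2 * (n + 1) * coeff (n + 1) (TT a) = a * ((if n = 0 then 1 else 0) +
    ∑ p ∈ Finset.HasAntidiagonal.antidiagonal n, coeff p.1 (TT a) * coeff p.2 (TT a)) := by
  have h := congrArg (coeff (R := ℚ) n) (TT_der a)
  have e : (a : PS) = C (a : ℚ) := by simp
  rw [two_mul, map_add, coeff_derivative, e, coeff_C_mul, map_add, coeff_mul, coeff_one] at h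
  linear_combination h

lemma TT_coeff (a k : ℕ) : coeff k (TT a) = a ^ k * tau k := by
  induction k using Nat.strong_induction_on with
  | _ k ih =>
    cases k with
    | zero => simp [tau, TT_const]
    | succ n =>
      have h0 : (2 * (n + 1) : ℚ) ≠ 0 := by positivity
      apply mul_left_cancel₀ h0
      have h1 := TT_rec 1 n
      rw [TT_rec]
      have : ∑ p ∈ Finset.HasAntidiagonal.antidiagonal n, coeff p.1 (TT a) * coeff p.2 (TT a) =
          a ^ n * ∑ p ∈ Finset.HasAntidiagonal.antidiagonal n, coeff p.1 (TT 1) * coeff p.2 (TT 1) := by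
        rw [Finset.mul_sum]
        refine Finset.sum_congr rfl fun p hp => ?_
        have hp' := Finset.HasAntidiagonal.mem_antidiagonal.1 hp
        rw [ih p.1 (by omega), ih p.2 (by omega), ← hp', pow_add, tau, tau]; ring
      rw [this, tau]
      have h2 : (if n = 0 then (1 : ℚ) else 0) = a ^ n * (if n = 0 then (1 : ℚ) else 0) := by
        split_ifs with h <;> simp [h]
      rw [h2]
      push_cast at h1
      linear_combination - (a : ℚ) ^ (n + 1) * h1

lemma tau_zero : tau 0 = 1 := by simp [tau, TT_const]
lemma tau_rec (n : ℕ) : 2 * (n + 1) * tau (n + 1) = (if n = 0 then 1 else 0) +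
    ∑ k ∈ Finset.range (n + 1), tau k * tau (n - k) := by
  have := TT_rec 1 n
  rw [Finset.Nat.sum_antidiagonal_eq_sum_range_succ_mk] at this
  simpa [tau] using this

lemma tau_nonneg (k : ℕ) : 0 ≤ tau k := by
  induction k using Nat.strong_induction_on with
  | _ k ih =>
    cases k with
    | zero => simp [tau_zero]
    | succ n =>
      have h0 : (0 : ℚ) < 2 * (n + 1) := by positivity
      apply nonneg_of_mul_nonneg_right _ h0
      rw [tau_rec]
      apply add_nonneg
      · split_ifs <;> norm_num
      · refine Finset.sum_nonneg fun k hk => mul_nonneg (ih _ ?_) (ih _ ?_)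
        · simpa using hk
        · omega

/-- scaled coefficients -/
def sig (k : ℕ) : ℚ := tau k * (3 / 2) ^ k

lemma sig_nonneg (k : ℕ) : 0 ≤ sig k := mul_nonneg (tau_nonneg k) (by positivity)

lemma sig_rec (n : ℕ) (hn : n ≠ 0) : (4 / 3) * (n + 1) * sig (n + 1) =
    ∑ k ∈ Finset.range (n + 1), sig k * sig (n - k) := by
  have h := tau_rec n
  rw [if_neg hn, zero_add] at h
  have : ∑ k ∈ Finset.range (n + 1), sig k * sig (n - k) =
      (3 / 2) ^ n * ∑ k ∈ Finset.range (n + 1), tau k * tau (n - k) := by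
    rw [Finset.mul_sum]
    refine Finset.sum_congr rfl fun k hk => ?_
    have : k + (n - k) = n := by have := Finset.mem_range.1 hk; omega
    rw [sig, sig, ← this, pow_add, this]; ring
  rw [this, ← h, sig, pow_succ]; ring

lemma sig0 : sig 0 = 1 := by simp [sig, tau_zero]
lemma sig1 : sig 1 = 3 / 2 := by
  have := tau_rec 0
  simp [tau_zero] at this
  rw [sig, show tau 1 = 1 by linarith]; norm_num
lemma sig2 : sig 2 = 9 / 8 := by
  have := sig_rec 1 (by norm_num)
  simp [Finset.sum_range_succ, sig0, sig1] at this; linarith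
lemma sig3 : sig 3 = 9 / 8 := by
  have := sig_rec 2 (by norm_num)
  simp [Finset.sum_range_succ, sig0, sig1, sig2] at this; linarith
lemma sig4 : sig 4 = 135 / 128 := by
  have := sig_rec 3 (by norm_num)
  simp [Finset.sum_range_succ, sig0, sig1, sig2, sig3] at this; linarith
lemma sig5 : sig 5 = 81 / 80 := by
  have := sig_rec 4 (by norm_num)
  simp [Finset.sum_range_succ, sig0, sig1, sig2, sig3, sig4] at this; linarith
lemma sig6 : sig 6 = 4941 / 5120 := by
  have := sig_rec 5 (by norm_num)
  simp [Finset.sum_range_succ, sig0, sig1, sig2, sig3, sig4, sig5] at this; linarith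
lemma sig7 : sig 7 = 4131 / 4480 := by
  have := sig_rec 6 (by norm_num)
  simp [Finset.sum_range_succ, sig0, sig1, sig2, sig3, sig4, sig5, sig6] at this; linarith
lemma sig8 : sig 8 < 1 := by
  have := sig_rec 7 (by norm_num)
  simp [Finset.sum_range_succ, sig0, sig1, sig2, sig3, sig4, sig5, sig6, sig7] at this; linarith

lemma sig_lt (n : ℕ) : (2 ≤ n → sig n ≤ 9 / 8) ∧ (8 ≤ n → sig n < 1) := by
  induction n using Nat.strong_induction_on with
  | _ n ih =>
    by_cases h9 : 9 ≤ n
    · suffices sig n < 1 from ⟨fun _ => by linarith, fun _ => this⟩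
      obtain ⟨m, rfl⟩ : ∃ m, n = m + 3 + 1 := ⟨n - 4, by omega⟩
      have h := sig_rec (m + 3) (by omega)
      rw [Finset.sum_range_succ, Finset.sum_range_succ, Finset.sum_range_succ',
        Finset.sum_range_succ'] at h
      have e1 : m + 3 - (m + 3) = 0 := by omega
      have e2 : m + 3 - (m + 2) = 1 := by omega
      have e3 : m + 3 - (0 + 1) = m + 2 := by omega
      rw [e1, e2, e3, Nat.sub_zero, zero_add, sig0, sig1] at h
      have b : ∑ k ∈ Finset.range m, sig (k + 1 + 1) * sig (m + 3 - (k + 1 + 1)) ≤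
          ∑ k ∈ Finset.range m, (81 / 64 : ℚ) := by
        refine Finset.sum_le_sum fun k hk => ?_
        have hk := Finset.mem_range.1 hk
        have h1 := (ih (k + 1 + 1) (by omega)).1 (by omega)
        have h2 := (ih (m + 3 - (k + 1 + 1)) (by omega)).1 (by omega)
        calc _ ≤ (9 / 8 : ℚ) * (9 / 8) := mul_le_mul h1 h2 (sig_nonneg _) (by norm_num)
          _ = _ := by norm_num
      simp only [Finset.sum_const, Finset.card_range, nsmul_eq_mul] at b
      have h2 := (ih (m + 2) (by omega)).1 (by omega)
      have h3 := (ih (m + 3) (by omega)).1 (by omega)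
      have hm : (5 : ℚ) ≤ m := by exact_mod_cast (by omega : 5 ≤ m)
      by_contra hc
      push Not at hc
      have hcast : ((m + 3 : ℕ) : ℚ) = m + 3 := by push_cast; rfl
      rw [hcast] at h
      have : (4 / 3) * ((m : ℚ) + 3 + 1) * 1 ≤ (4 / 3) * ((m : ℚ) + 3 + 1) * sig (m + 3 + 1) :=
        mul_le_mul_of_nonneg_left hc (by positivity)
      linarith
    · have hn : n < 9 := by omega
      have h8 := sig8
      interval_cases n <;> simp [sig2, sig3, sig4, sig5, sig6, sig7, h8] <;>
        linarith

/-- the generating functions -/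
def GG (s i : ℕ) : PS := cK (2 * i + 1) * TT (2 * s + 1) - sK (2 * i + 1)

lemma GG_const (s i : ℕ) : cc 0 (GG s i) = 1 := by
  simp [cc_zero, GG, K_const, TT_const]
lemma GG_top (s : ℕ) : GG s s = 1 := by
  rw [GG, TT_mul]; ring
lemma GG_rec (i j : ℕ) : GG (i + j + 1) i = GG (i + j + 1) (i + 1) + xx * GG (i + j + 1) j := by
  set u := 2 * (i + j + 1) + 1 with hu
  have hT := TT_mul u
  have hT' := TT_mul' u
  have eu : u = (2 * j + 1) + (2 * i + 1 + 1) := by omega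
  have h1 := (K_add (2 * j + 1) (2 * i + 1 + 1)).1
  have h2 := (K_add (2 * j + 1) (2 * i + 1 + 1)).2
  rw [← eu] at h1 h2
  have sq := K_sq (2 * i + 1 + 1)
  have hj : GG (i + j + 1) j = cK (2 * i + 1 + 1) + sK (2 * i + 1 + 1) * TT u := by
    rw [GG, ← hu]
    set p := 2 * i + 1 + 1
    have a1 : cK (2 * j + 1) = cK u * cK p + sK u * sK p := by
      rw [h1, h2]; linear_combination - cK (2 * j + 1) * sq
    have a2 : sK (2 * j + 1) = sK u * cK p - cK u * sK p := by
      rw [h1, h2]; linear_combination - sK (2 * j + 1) * sq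
    rw [a1, a2]
    linear_combination cK p * hT + sK p * hT'
  rw [hj, GG, GG, ← hu]
  have e : 2 * (i + 1) + 1 = 2 * i + 1 + 1 + 1 := by ring
  rw [e, cKs (2 * i + 1 + 1), sKs (2 * i + 1 + 1), cKs (2 * i + 1), sKs (2 * i + 1), xx]
  set c := cK (2 * i + 1)
  set s := sK (2 * i + 1)
  linear_combination (s - c * TT u) * csq

lemma cc_GG0 (s n : ℕ) (hn : 2 ≤ n) : cc n (GG s 0) =
    ∑ k ∈ Finset.range (n + 1), (2 * s + 1 : ℚ) ^ k * tau k * cc n (cs * X ^ k) := by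
  have e : GG s 0 = cs * TT (2 * s + 1) - xx * C (1 / 2) := by
    have h2 : (2 : PS) * C (1 / 2) = 1 := by
      rw [← map_ofNat (C (R := ℚ)) 2, ← map_mul]; norm_num
    rw [GG, show 2 * 0 + 1 = 1 by rfl, cK1, sK1, xx]
    linear_combination sn * h2
  obtain ⟨m, rfl⟩ : ∃ m, n = m + 1 + 1 := ⟨n - 2, by omega⟩
  rw [e, map_sub, cc_succ_xx, cc_succ_C, sub_zero, cc_expand]
  refine Finset.sum_congr rfl fun k _ => ?_
  rw [TT_coeff]; push_cast; ring

end
end ZZ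

namespace ZZ
open Finset

lemma zz_succ (n s : ℕ) (f : Fin (n + 1) → Fin s) : ZigzagMono (n + 1) s f ↔
    (∀ hn : 0 < n, f (Fin.succ ⟨0, hn⟩) ≤ f 0) ∧ ZigzagMono n s (fun k => (f k.succ).rev) := by
  constructor
  · intro H
    refine ⟨fun hn => ?_, fun j hj => ?_⟩
    · simpa using H 0 (by omega)
    · have := H (j + 1) (by omega)
      simp only [Fin.rev_le_rev, Fin.succ_mk]
      by_cases ho : Odd j
      · have h2 : ¬ Odd (j + 1) := by grind
        simpa [ho, h2] using this
      · have h2 : Odd (j + 1) := by grind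
        simpa [ho, h2] using this
  · rintro ⟨h0, H⟩ j hj
    cases j with
    | zero =>
      have := h0 (by omega)
      simp only [Fin.succ_mk] at this
      simpa using this
    | succ j =>
      have := H j (by omega)
      simp only [Fin.rev_le_rev, Fin.succ_mk] at this
      by_cases ho : Odd j
      · have h2 : ¬ Odd (j + 1) := by grind
        simpa [ho, h2] using this
      · have h2 : Odd (j + 1) := by grind
        simpa [ho, h2] using this

open Classical in
noncomputable def FF (n s i : ℕ) : Finset (Fin n → Fin s) :=
  univ.filter fun f => ZigzagMono n s f ∧ ∀ h : 0 < n, i ≤ (f ⟨0, h⟩).val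

lemma FF_zero (s i : ℕ) : (FF 0 s i).card = 1 := by
  classical
  have : FF 0 s i = univ := by
    apply Finset.filter_true_of_mem
    intro f _
    exact ⟨fun j hj => by omega, fun h => by omega⟩
  rw [this]; simp

lemma FF_top (n s : ℕ) : (FF (n + 1) s s).card = 0 := by
  classical
  rw [Finset.card_eq_zero]
  apply Finset.filter_false_of_mem
  intro f _ h
  have := h.2 (by omega)
  have := (f ⟨0, by omega⟩).isLt
  omega

lemma FF_rec (n i j : ℕ) : (FF (n + 1) (i + j + 1) i).card =
    (FF (n + 1) (i + j + 1) (i + 1)).card + (FF n (i + j + 1) j).card := by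
  classical
  set s := i + j + 1 with hs
  have hsub : FF (n + 1) s (i + 1) ⊆ FF (n + 1) s i := by
    intro f hf
    simp only [FF, mem_filter, mem_univ, true_and] at hf ⊢
    exact ⟨hf.1, fun h => by have := hf.2 h; omega⟩
  rw [← Finset.card_sdiff_add_card_eq_card hsub, add_comm]
  congr 1
  have hmem : ∀ f, f ∈ FF (n + 1) s i \ FF (n + 1) s (i + 1) ↔
      ZigzagMono (n + 1) s f ∧ (f 0).val = i := by
    intro f
    simp only [FF, mem_sdiff, mem_filter, mem_univ, true_and]
    constructor
    · rintro ⟨⟨h1, h2⟩, h3⟩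
      refine ⟨h1, ?_⟩
      by_contra hne
      apply h3
      refine ⟨h1, fun h => ?_⟩
      have := h2 h
      change i ≤ (f 0).val at this
      change i + 1 ≤ (f 0).val
      omega
    · rintro ⟨h1, h2⟩
      refine ⟨⟨h1, fun h => ?_⟩, fun h => ?_⟩
      · change i ≤ (f 0).val; omega
      · have := h.2 (by omega)
        change i + 1 ≤ (f 0).val at this; omega
  refine Finset.card_bij' (fun f _ => fun k => (f k.succ).rev)
    (fun h _ => Fin.cons (⟨i, by omega⟩ : Fin s) (fun k => (h k).rev)) ?_ ?_ ?_ ?_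
  · intro f hf
    obtain ⟨h1, h2⟩ := (hmem f).1 hf
    obtain ⟨h3, h4⟩ := (zz_succ n s f).1 h1
    simp only [FF, mem_filter, mem_univ, true_and]
    refine ⟨h4, fun h => ?_⟩
    have := h3 h
    rw [Fin.le_def] at this
    rw [Fin.val_rev]; omega
  · intro h hh
    simp only [FF, mem_filter, mem_univ, true_and] at hh
    rw [hmem, zz_succ]
    refine ⟨⟨fun hn => ?_, ?_⟩, ?_⟩
    · have := hh.2 hn
      simp only [Fin.cons_succ, Fin.cons_zero, Fin.le_def, Fin.val_rev]; omega
    · simpa using hh.1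
    · simp
  · intro f hf
    obtain ⟨h1, h2⟩ := (hmem f).1 hf
    funext k
    refine Fin.cases ?_ (fun k => ?_) k
    · simp only [Fin.cons_zero]; exact Fin.ext h2.symm
    · simp
  · intro h hh
    funext k; simp

lemma FF_eq (n : ℕ) : ∀ s i, i ≤ s → ((FF n s i).card : ℚ) = cc n (GG s i) := by
  induction n with
  | zero => intro s i _; rw [FF_zero, GG_const]; simp
  | succ n ih =>
    intro s i hi
    induction hi using Nat.decreasingInduction with
    | self => rw [FF_top, GG_top, ← map_one PowerSeries.C, cc_succ_C]; simp
    | of_succ i hi ih2 =>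
      obtain ⟨j, rfl⟩ : ∃ j, s = i + j + 1 := ⟨s - i - 1, by omega⟩
      rw [FF_rec, GG_rec, map_add, cc_succ_xx, ← ih2, ← ih _ _ (by omega)]; push_cast; rfl

lemma card_eq (n s : ℕ) : (Nat.card {f : Fin n → Fin s // ZigzagMono n s f} : ℚ) =
    cc n (GG s 0) := by
  classical
  rw [← FF_eq n s 0 (Nat.zero_le _), FF, Nat.card_eq_fintype_card, Fintype.card_subtype]
  simp

lemma card_one (n : ℕ) : Nat.card {f : Fin n → Fin 1 // ZigzagMono n 1 f} = 1 := by
  rw [Nat.card_eq_one_iff_unique]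
  refine ⟨⟨fun a b => Subtype.ext (Subsingleton.elim _ _)⟩, ⟨⟨fun _ => 0, fun j h => ?_⟩⟩⟩
  split_ifs <;> exact le_refl _

lemma euler_le (n s : ℕ) : EulerNumber n * s.choose n ≤
    Nat.card {f : Fin n → Fin s // ZigzagMono n s f} := by
  classical
  have h1 : s.choose n = Nat.card {S : Finset (Fin s) // S.card = n} := by
    rw [Nat.card_eq_fintype_card, Fintype.card_finset_len, Fintype.card_fin]
  rw [EulerNumber, h1, ← Nat.card_prod]
  apply Nat.card_le_card_of_injective (f := fun p =>
    (⟨fun k => p.2.1.orderEmbOfFin p.2.2 (p.1.1 k), by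
      intro j hj
      have := p.1.2 j hj
      by_cases ho : Odd j
      · have he : ¬ Even j := by grind
        simp only [ho, he, if_true, if_false] at this ⊢
        exact (p.2.1.orderEmbOfFin p.2.2).monotone this.le
      · have he : Even j := by grind
        simp only [ho, he, if_true, if_false] at this ⊢
        exact (p.2.1.orderEmbOfFin p.2.2).monotone this.le⟩ :
      {f : Fin n → Fin s // ZigzagMono n s f}))
  rintro ⟨⟨σ, hσ⟩, ⟨S, hS⟩⟩ ⟨⟨τ, hτ⟩, ⟨S', hS'⟩⟩ h
  have h := congrArg Subtype.val h
  simp only at h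
  have hr : ∀ (S : Finset (Fin s)) (hS : S.card = n) (σ : Equiv.Perm (Fin n)),
      Set.range (fun k => S.orderEmbOfFin hS (σ k)) = S := by
    intro S hS σ
    rw [← Finset.range_orderEmbOfFin S hS]
    exact σ.surjective.range_comp (S.orderEmbOfFin hS)
  have hSS : S = S' := by
    have := hr S hS σ
    rw [h, hr S' hS' τ] at this
    exact_mod_cast this.symm
  subst hSS
  have : σ = τ := by
    ext k : 1
    exact (S.orderEmbOfFin hS).injective (congrFun h k)
  subst this
  rfl

noncomputable section

/-- coefficients in powers of `2s+1`. -/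
def pp (n k : ℕ) : ℚ := tau k * cc n (cs * PowerSeries.X ^ k)

open Polynomial in
lemma poly_eq (P : Polynomial ℚ) (n : ℕ) (hn : 2 ≤ n)
    (hP : ∀ t : ℕ, 0 < t →
      P.eval (t : ℚ) = (Nat.card {f : Fin n → Fin t // ZigzagMono n t f} : ℚ)) :
    P = ∑ k ∈ Finset.range (n + 1), C (pp n k) * (2 * X + 1) ^ k := by
  apply Polynomial.eq_of_infinite_eval_eq
  apply Set.infinite_of_injective_forall_mem (f := fun t : ℕ => ((t + 1 : ℕ) : ℚ))
  · intro a b h; simpa using h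
  · intro t
    rw [Set.mem_ofPred_eq, hP (t + 1) (by omega), card_eq, cc_GG0 _ _ hn, Polynomial.eval_finsetSum]
    refine Finset.sum_congr rfl fun k _ => ?_
    simp [pp]; ring

lemma pp_top (n : ℕ) : pp n n = tau n / 2 ^ n := by
  rw [pp, cc_cos_top]; ring

open Polynomial in
lemma poly_coeff (n : ℕ) :
    (∑ k ∈ Finset.range (n + 1), C (pp n k) * (2 * X + 1 : ℚ[X]) ^ k).coeff n = tau n ∧
    (∑ k ∈ Finset.range (n + 1), C (pp n k) * (2 * X + 1 : ℚ[X]) ^ k).natDegree ≤ n := by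
  have hl : (2 * X + 1 : ℚ[X]) = C 2 * X + C 1 := by rw [C_1]; rfl
  have hd : ∀ k, ((2 * X + 1 : ℚ[X]) ^ k).natDegree ≤ k := by
    intro k
    refine (natDegree_pow_le).trans ?_
    have : (2 * X + 1 : ℚ[X]).natDegree ≤ 1 := by rw [hl]; exact natDegree_linear_le
    nlinarith
  constructor
  · rw [finsetSum_coeff, Finset.sum_range_succ, Finset.sum_eq_zero, zero_add, coeff_C_mul, pp_top]
    · have : ((2 * X + 1 : ℚ[X]) ^ n).coeff n = 2 ^ n := by
        have := coeff_pow_of_natDegree_le (p := (2 * X + 1 : ℚ[X])) (n := 1) (m := n)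
          (by rw [hl]; exact natDegree_linear_le)
        rw [mul_one] at this
        rw [this, hl]; simp [-map_one]
      rw [this]; field_simp
    · intro k hk
      rw [coeff_C_mul, coeff_eq_zero_of_natDegree_lt, mul_zero]
      exact (hd k).trans_lt (Finset.mem_range.1 hk)
  · refine natDegree_sum_le_of_forall_le _ _ fun k hk => ?_
    refine (natDegree_C_mul_le _ _).trans ((hd k).trans ?_)
    have := Finset.mem_range.1 hk; omega

open Polynomial in
lemma euler_tau (P : Polynomial ℚ) (n : ℕ) (hn : 2 ≤ n)
    (hP : ∀ t : ℕ, 0 < t →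
      P.eval (t : ℚ) = (Nat.card {f : Fin n → Fin t // ZigzagMono n t f} : ℚ)) :
    (EulerNumber n : ℚ) / n.factorial ≤ tau n := by
  obtain ⟨hc, hd⟩ := poly_coeff n
  rw [← poly_eq P n hn hP] at hc hd
  by_contra hlt
  push Not at hlt
  set e : ℚ := (EulerNumber n : ℚ) / n.factorial with he
  set D : ℚ[X] := P - C e * (X + C (1 - n : ℚ)) ^ n with hD
  have hDc : D.coeff n = tau n - e := by
    rw [hD, coeff_sub, coeff_C_mul, hc]
    have := (monic_X_add_C (1 - n : ℚ)).pow n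
    have h2 : ((X + C (1 - n : ℚ)) ^ n).natDegree = n := by
      rw [natDegree_pow, natDegree_X_add_C, mul_one]
    have h3 : ((X + C (1 - n : ℚ)) ^ n).coeff n = 1 := by
      rw [Polynomial.Monic, leadingCoeff, h2] at this
      exact this
    rw [h3, mul_one]
  have hDd : D.natDegree ≤ n := by
    rw [hD]
    refine (natDegree_sub_le _ _).trans (max_le hd ((natDegree_C_mul_le _ _).trans ?_))
    rw [natDegree_pow, natDegree_X_add_C, mul_one]
  have hne : D.coeff n ≠ 0 := by rw [hDc]; linarith
  have hDn : D.natDegree = n := le_antisymm hDd (le_natDegree_of_ne_zero hne)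
  have hlead : D.leadingCoeff ≤ 0 := by rw [leadingCoeff, hDn, hDc]; linarith
  have hdeg : 0 < D.degree := natDegree_pos_iff_degree_pos.1 (by omega)
  have ht := (D.tendsto_atBot_of_leadingCoeff_nonpos hdeg hlead).comp
    (tendsto_natCast_atTop_atTop (R := ℚ))
  obtain ⟨s, hs1, hs2⟩ := ((ht.eventually_lt_atBot 0).and
    (Filter.eventually_ge_atTop (n + 1))).exists
  simp only [Function.comp, hD, eval_sub, eval_mul, eval_C, eval_pow, eval_add, eval_X] at hs1
  rw [hP s (by omega)] at hs1
  have h1 : ((EulerNumber n * s.choose n : ℕ) : ℚ) ≤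
      (Nat.card {f : Fin n → Fin s // ZigzagMono n s f} : ℚ) := by exact_mod_cast euler_le n s
  have h2 : (((s + 1 - n) ^ n : ℕ) : ℚ) ≤ ((s.descFactorial n : ℕ) : ℚ) := by
    exact_mod_cast Nat.pow_sub_le_descFactorial s n
  rw [Nat.descFactorial_eq_factorial_mul_choose] at h2
  push_cast [Nat.cast_sub (show n ≤ s + 1 by omega)] at h1 h2
  have hf : (0 : ℚ) < n.factorial := by positivity
  have h3 : e * (s + (1 - n)) ^ n ≤ (EulerNumber n : ℚ) * s.choose n := by
    rw [he, div_mul_eq_mul_div, div_le_iff₀ hf, mul_assoc]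
    refine mul_le_mul_of_nonneg_left ?_ (by positivity)
    calc _ = ((s : ℚ) + 1 - n) ^ n := by ring
      _ ≤ _ := h2
      _ = _ := by ring
  linarith

lemma main (P : Polynomial ℚ) (n : ℕ) (hn : 8 ≤ n)
    (hP : ∀ t : ℕ, 0 < t →
      P.eval (t : ℚ) = (Nat.card {f : Fin n → Fin t // ZigzagMono n t f} : ℚ))
    (t : ℝ) (ht : 3 / 2 ≤ t) :
    (EulerNumber n : ℝ) / (n.factorial : ℝ) * t ^ n < Polynomial.aeval (t - 1 / 2 : ℝ) P := by
  have hE := euler_tau P n (by omega) hP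
  have hpoly := poly_eq P n (by omega) hP
  have h1 : ∑ k ∈ Finset.range (n + 1), pp n k * 3 ^ k = 1 := by
    have := hP 1 one_pos
    rw [card_one] at this
    conv_lhs at this => rw [hpoly]
    rw [Polynomial.eval_finsetSum] at this
    simp only [Polynomial.eval_mul, Polynomial.eval_C, Polynomial.eval_pow, Polynomial.eval_add,
      Polynomial.eval_X, Polynomial.eval_one, Polynomial.eval_ofNat] at this
    norm_num at this
    exact this
  rw [Finset.sum_range_succ, pp_top] at h1
  have hs := (sig_lt n).2 hn
  rw [sig, div_pow] at hs
  have hpos : 0 < ∑ k ∈ Finset.range n, pp n k * 3 ^ k := by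
    have : tau n / 2 ^ n * 3 ^ n = tau n * (3 ^ n / 2 ^ n) := by ring
    linarith
  have hval : Polynomial.aeval (t - 1 / 2 : ℝ) P =
      ∑ k ∈ Finset.range (n + 1), (pp n k : ℝ) * (2 * t) ^ k := by
    rw [hpoly, map_sum]
    refine Finset.sum_congr rfl fun k _ => ?_
    simp only [map_mul, map_pow, map_add, Polynomial.aeval_C, Polynomial.aeval_X, map_one,
      map_ofNat, eq_ratCast]
    ring
  rw [hval, Finset.sum_range_succ, pp_top]
  have htop : ((tau n / 2 ^ n : ℚ) : ℝ) * (2 * t) ^ n = (tau n : ℝ) * t ^ n := by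
    push_cast; rw [mul_pow]; field_simp
  rw [htop]
  have hE' : (EulerNumber n : ℝ) / (n.factorial : ℝ) ≤ (tau n : ℝ) := by
    have := (Rat.cast_le (K := ℝ)).2 hE
    push_cast at this; exact this
  have hle : (EulerNumber n : ℝ) / (n.factorial : ℝ) * t ^ n ≤ (tau n : ℝ) * t ^ n :=
    mul_le_mul_of_nonneg_right hE' (by positivity)
  suffices 0 < ∑ k ∈ Finset.range n, (pp n k : ℝ) * (2 * t) ^ k by linarith
  obtain ⟨m, rfl⟩ : ∃ m, n = m + 1 := ⟨n - 1, by omega⟩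
  obtain ⟨K, hK⟩ := cos_sign m
  set r : ℝ := 2 * t / 3 with hr
  have hr1 : 1 ≤ r := by rw [hr]; linarith
  have hpos' : (0 : ℝ) < ∑ k ∈ Finset.range (m + 1), (pp (m + 1) k : ℝ) * 3 ^ k := by
    exact_mod_cast hpos
  have : r ^ K * ∑ k ∈ Finset.range (m + 1), (pp (m + 1) k : ℝ) * 3 ^ k ≤
      ∑ k ∈ Finset.range (m + 1), (pp (m + 1) k : ℝ) * (2 * t) ^ k := by
    rw [Finset.mul_sum]
    refine Finset.sum_le_sum fun k _ => ?_
    have e : (2 * t) ^ k = 3 ^ k * r ^ k := by rw [← mul_pow, hr]; congr 1; ring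
    rw [e]
    have h3 : (0 : ℝ) ≤ 3 ^ k := by positivity
    rcases lt_or_ge k K with h | h
    · have hp : (pp (m + 1) k : ℝ) ≤ 0 := by
        exact_mod_cast mul_nonpos_of_nonneg_of_nonpos (tau_nonneg k) ((hK k).1 h)
      have := pow_le_pow_right₀ hr1 h.le
      have h4 : (pp (m + 1) k : ℝ) * 3 ^ k ≤ 0 := mul_nonpos_of_nonpos_of_nonneg hp h3
      nlinarith
    · have hp : (0 : ℝ) ≤ (pp (m + 1) k : ℝ) := by
        exact_mod_cast mul_nonneg (tau_nonneg k) ((hK k).2 h)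
      have := pow_le_pow_right₀ hr1 h
      have h4 : 0 ≤ (pp (m + 1) k : ℝ) * 3 ^ k := mul_nonneg hp h3
      nlinarith
  have : 0 < r ^ K * ∑ k ∈ Finset.range (m + 1), (pp (m + 1) k : ℝ) * 3 ^ k :=
    mul_pos (by positivity) hpos'
  linarith

end
end ZZ

/-- for every integer `n ≥ 8` and every real `t ≥ 3/2`,
`Ω(Z_n; t − 1/2) > (E_n/n!)·t^n`; in particular, for every integer `n ≥ 8` and
every integer `p ≥ 3`, `Ω(Z_n; p/2 − 1/2) > (E_n/n!)·(p/2)^n`. -/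
theorem zigzag_shifted_lower_bound (Ω : ℕ → Polynomial ℚ)
    (hΩ : ∀ m t : ℕ, 0 < t →
      (Ω m).eval (t : ℚ) = (Nat.card {f : Fin m → Fin t // ZigzagMono m t f} : ℚ)) :
    (∀ n : ℕ, 8 ≤ n → ∀ t : ℝ, 3 / 2 ≤ t →
      (EulerNumber n : ℝ) / (n.factorial : ℝ) * t ^ n <
        Polynomial.aeval (t - 1 / 2 : ℝ) (Ω n)) ∧
    ∀ n : ℕ, 8 ≤ n → ∀ p : ℤ, 3 ≤ p →
      (EulerNumber n : ℝ) / (n.factorial : ℝ) * ((p : ℝ) / 2) ^ n <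
        Polynomial.aeval ((p : ℝ) / 2 - 1 / 2) (Ω n) := by
  exact ⟨fun n hn t ht => ZZ.main (Ω n) n hn (hΩ n) t ht, fun n hn p hp =>
    ZZ.main (Ω n) n hn (hΩ n) _ (by
      have : (3 : ℝ) ≤ (p : ℝ) := by exact_mod_cast hp
      linarith)⟩
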